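/- Fix integers n, d ≥ 1. Let P(·,·|a,b), for a ∈ 𝒜_n and b ∈ ℬ_n, be a family of probability distributions on pairs (x,y) ∈ {0,...,d} × {0,...,d} that is no-signalling, i.e., Σ_y P(x,y|a,b) does not depend on b (call it P(x|a)) and Σ_x P(x,y|a,b) does not depend on a. Then Σ_{x=0}^{d−1} |P(x|a=0) − 1/d| ≤ (d/2) · I_{n,d}(P). -/

import Mathlib

/-- The set of measurement settings `𝒜_n = {0, 2, 4, …, 2n−2}`. -/
def settingsA (n : ℕ) : Finset ℕ := (Finset.range n).image (fun i => 2 * i)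

/-- The set of measurement settings `ℬ_n = {1, 3, 5, …, 2n−1}`. -/
def settingsB (n : ℕ) : Finset ℕ := (Finset.range n).image (fun i => 2 * i + 1)

/-- The chained-Bell expression
`I_{n,d}(P) = 2n − Σ_{x<d} P(x, x⊕1 | 0, 2n−1) − Σ_{a∈𝒜_n, b∈ℬ_n, |a−b|=1} Σ_{x<d} P(x,x|a,b)`,
where `P a b x y` denotes the conditional probability `P(x,y|a,b)` of outcomes
`x, y ∈ {0,…,d}` given settings `a, b`, and `⊕` is addition modulo `d`. -/
noncomputable def chainedBell (n d : ℕ) (P : ℕ → ℕ → ℕ → ℕ → ℝ) : ℝ :=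
  2 * n - (∑ x ∈ Finset.range d, P 0 (2 * n - 1) x ((x + 1) % d))
    - ∑ a ∈ settingsA n, ∑ b ∈ settingsB n,
        if a + 1 = b ∨ b + 1 = a then ∑ x ∈ Finset.range d, P a b x x else 0

open Finset in
/-- If `X, Y ∈ {0,…,d}` have joint distribution `J` and `σ` permutes `{0,…,d−1}`, then the distance
between the marginals matched along `σ`, together with the mass both marginals place on the
outcome `d`, is at most twice the probability that `X = x < d` and `Y = σ x` fails. -/
theorem sum_abs_marginal_sub_le {d : ℕ} {J : ℕ → ℕ → ℝ} (hJ : ∀ x y, 0 ≤ J x y)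
    (hJ1 : ∑ x ∈ range (d + 1), ∑ y ∈ range (d + 1), J x y = 1)
    {σ : ℕ → ℕ} (hσ : Set.BijOn σ (range d : Set ℕ) (range d : Set ℕ)) :
    ∑ x ∈ range d, |∑ y ∈ range (d + 1), J x y - ∑ x' ∈ range (d + 1), J x' (σ x)|
        + ∑ y ∈ range (d + 1), J d y + ∑ x ∈ range (d + 1), J x d
      ≤ 2 * (1 - ∑ x ∈ range d, J x (σ x)) := by
  have hrow : ∑ x ∈ range d, ∑ y ∈ range (d + 1), J x y
      = 1 - ∑ y ∈ range (d + 1), J d y := by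
    rw [sum_range_succ] at hJ1; linarith
  have hcol : ∑ x ∈ range d, ∑ x' ∈ range (d + 1), J x' (σ x)
      = 1 - ∑ x ∈ range (d + 1), J x d := by
    rw [sum_nbij σ hσ.mapsTo hσ.injOn hσ.surjOn
      (g := fun y => ∑ x' ∈ range (d + 1), J x' y) fun _ _ => rfl]
    rw [sum_comm, sum_range_succ] at hJ1; linarith
  have hle : ∑ x ∈ range d, |∑ y ∈ range (d + 1), J x y - ∑ x' ∈ range (d + 1), J x' (σ x)|
      ≤ ∑ x ∈ range d, (∑ y ∈ range (d + 1), J x y + ∑ x' ∈ range (d + 1), J x' (σ x)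
        - 2 * J x (σ x)) := by
    refine sum_le_sum fun x hx => ?_
    have hσx : σ x < d := mem_range.1 (hσ.mapsTo hx)
    have hx' : x < d := mem_range.1 hx
    have hr := single_le_sum (f := fun y => J x y) (fun y _ => hJ x y)
      (mem_range.2 (hσx.trans d.lt_succ_self))
    have hc := single_le_sum (f := fun x' => J x' (σ x)) (fun x' _ => hJ x' (σ x))
      (mem_range.2 (hx'.trans d.lt_succ_self))
    rw [abs_le]
    constructor <;> linarith
  rw [sum_sub_distrib, sum_add_distrib, hrow, hcol, ← mul_sum] at hle
  linarith

open Finset in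
theorem bijOn_add_one_mod (d : ℕ) :
    Set.BijOn (fun x => (x + 1) % d) (range d : Set ℕ) (range d : Set ℕ) := by
  have hmaps : Set.MapsTo (fun x => (x + 1) % d) (range d : Set ℕ) (range d : Set ℕ) := by
    intro x hx
    simp only [coe_range, Set.mem_Iio] at hx ⊢
    exact Nat.mod_lt _ (by omega)
  have hinj : Set.InjOn (fun x => (x + 1) % d) (range d : Set ℕ) := by
    intro x hx y hy hxy
    simp only [coe_range, Set.mem_Iio] at hx hy
    exact (Nat.ModEq.add_right_cancel' 1 hxy).eq_of_lt_of_lt hx hy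
  exact ⟨hmaps, hinj, surjOn_of_injOn_of_card_le _ hmaps hinj le_rfl⟩

open Finset in
/-- On a cycle, the difference of two values is at most half of the total variation. -/
theorem two_mul_sub_le_sum_abs_sub_cyclic {d : ℕ} (p : ℕ → ℝ) {i j : ℕ} (hi : i < d)
    (hj : j < d) :
    2 * (p i - p j) ≤ ∑ x ∈ range d, |p x - p ((x + 1) % d)| := by
  wlog hij : i ≤ j generalizing p i j
  · have h := this (-p) hj hi (le_of_not_ge hij)
    simp only [Pi.neg_apply, neg_sub_neg] at h
    simpa only [abs_sub_comm] using h
  let f : ℕ → ℝ := fun k => p (k % d)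
  have hf : ∀ k, k < d → f k = p k := fun k hk => by simp [f, Nat.mod_eq_of_lt hk]
  have hsum : ∑ x ∈ range d, |p x - p ((x + 1) % d)| = ∑ x ∈ range d, dist (f x) (f (x + 1)) :=
    sum_congr rfl fun x hx => by rw [Real.dist_eq, hf x (mem_range.1 hx)]
  have hd0 : f d = f 0 := by simp [f]
  have h₁ := dist_le_Ico_sum_dist f hij
  have h₂ := dist_le_Ico_sum_dist f hj.le
  have h₃ := dist_le_Ico_sum_dist f i.zero_le
  have h₄ := sum_Ico_consecutive (fun k => dist (f k) (f (k + 1))) i.zero_le hij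
  have h₅ := sum_Ico_consecutive (fun k => dist (f k) (f (k + 1))) j.zero_le hj.le
  rw [hsum, range_eq_Ico]
  rw [Real.dist_eq, hf i hi] at h₁ h₃
  rw [hf j hj] at h₁
  rw [Real.dist_eq, hf j hj, hd0] at h₂
  have := le_abs_self (p i - p j)
  have := neg_abs_le (p j - f 0)
  have := neg_abs_le (f 0 - p i)
  linarith

open Finset in
/-- The total deviation from the mean of `d` numbers is at most `d / 2` times their range. -/
theorem sum_abs_sub_mean_le {d : ℕ} (hd : 1 ≤ d) (p : ℕ → ℝ) {R : ℝ}
    (hR : ∀ i < d, ∀ j < d, p i - p j ≤ R) :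
    ∑ x ∈ range d, |p x - (∑ y ∈ range d, p y) / d| ≤ d / 2 * R := by
  have hne : (range d).Nonempty := nonempty_range_iff.2 (by omega)
  obtain ⟨i, hi, hmax⟩ := exists_max_image (range d) p hne
  obtain ⟨j, hj, hmin⟩ := exists_min_image (range d) p hne
  have hij := hR i (mem_range.1 hi) j (mem_range.1 hj)
  have hR0 : 0 ≤ R := by linarith [hmax j hj]
  have hd0 : (0 : ℝ) < d := by exact_mod_cast hd
  set m : ℝ := (∑ y ∈ range d, p y) / d with hm
  have hmean : ∑ x ∈ range d, (p x - m) = 0 := by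
    rw [sum_sub_distrib, sum_const, card_range, nsmul_eq_mul, hm]
    field_simp
    ring
  have hsq : ∑ x ∈ range d, |p x - m| ^ 2 ≤ d * (R / 2) ^ 2 := by
    calc ∑ x ∈ range d, |p x - m| ^ 2
        ≤ ∑ x ∈ range d, ((p i + p j - 2 * m) * (p x - m) + (p i - m) * (m - p j)) := by
          refine sum_le_sum fun x hx => ?_
          rw [sq_abs]
          nlinarith [mul_nonneg (sub_nonneg.2 (hmax x hx)) (sub_nonneg.2 (hmin x hx))]
      _ = d * ((p i - m) * (m - p j)) := by
          rw [sum_add_distrib, ← mul_sum, hmean]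
          simp
      _ ≤ d * (R / 2) ^ 2 := by
          refine mul_le_mul_of_nonneg_left ?_ hd0.le
          nlinarith [sq_nonneg ((p i - m) - (m - p j)), hmax j hj]
  have hcs := sq_sum_le_card_mul_sum_sq (s := range d) (f := fun x => |p x - m|)
  rw [card_range] at hcs
  refine abs_le_of_sq_le_sq' ?_ (by positivity) |>.2
  calc (∑ x ∈ range d, |p x - m|) ^ 2 ≤ d * ∑ x ∈ range d, |p x - m| ^ 2 := hcs
    _ ≤ d * (d * (R / 2) ^ 2) := mul_le_mul_of_nonneg_left hsq hd0.le
    _ = (d / 2 * R) ^ 2 := by ring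

open Finset in
theorem sum_settings_adjacent (m : ℕ) (f : ℕ → ℕ → ℝ) :
    ∑ a ∈ settingsA (m + 1), ∑ b ∈ settingsB (m + 1),
        (if a + 1 = b ∨ b + 1 = a then f a b else 0)
      = ∑ i ∈ range (m + 1), f (2 * i) (2 * i + 1)
        + ∑ i ∈ range m, f (2 * (i + 1)) (2 * i + 1) := by
  have hsplit : ∀ i j : ℕ,
      (if 2 * i + 1 = 2 * j + 1 ∨ 2 * j + 1 + 1 = 2 * i then f (2 * i) (2 * j + 1) else 0)
        = (if i = j then f (2 * i) (2 * j + 1) else 0)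
          + (if i = j + 1 then f (2 * i) (2 * j + 1) else 0) := by
    intro i j
    split_ifs <;> first | omega | simp
  rw [settingsA, settingsB, sum_image (fun _ _ _ _ h => by simpa using h)]
  simp_rw [sum_image (s := range (m + 1)) (g := fun i => 2 * i + 1)
    (fun _ _ _ _ h => by simpa using h), hsplit, sum_add_distrib]
  congr 1
  · refine sum_congr rfl fun i hi => ?_
    rw [sum_ite_eq, if_pos hi]
  · rw [sum_comm, sum_range_succ]
    simp only [sum_ite_eq', mem_range]
    simp +contextual [Finset.sum_congr]

open Finset in
/-- Triangle inequality along the chain of settings `0, 1, 2, …, 2m+1`: the marginals `r i` and `c i`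
of the settings `2i` and `2i+1` are compared on `{0,…,d−1}`. -/
theorem sum_abs_sub_le_of_chain {d : ℕ} {r c : ℕ → ℕ → ℝ} {e e' : ℕ → ℝ} (m : ℕ)
    (hr : ∀ i ≤ m, 0 ≤ r i d) (hc : ∀ i ≤ m, 0 ≤ c i d)
    (he : ∀ i ≤ m, ∑ x ∈ range d, |r i x - c i x| + r i d + c i d ≤ 2 * e i)
    (he' : ∀ i < m, ∑ x ∈ range d, |r (i + 1) x - c i x| + r (i + 1) d + c i d ≤ 2 * e' i) :
    ∑ x ∈ range d, |r 0 x - c m x| + r 0 d + c m d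
      ≤ 2 * (∑ i ∈ range (m + 1), e i + ∑ i ∈ range m, e' i) := by
  induction m with
  | zero => simpa using he 0 le_rfl
  | succ m ih =>
    have h₀ := ih (fun i hi => hr i (by omega)) (fun i hi => hc i (by omega))
      (fun i hi => he i (by omega)) (fun i hi => he' i (by omega))
    have h₁ := he (m + 1) le_rfl
    have h₂ := he' m (by omega)
    have htri : ∑ x ∈ range d, |r 0 x - c (m + 1) x| ≤ ∑ x ∈ range d, |r 0 x - c m x|
        + ∑ x ∈ range d, |r (m + 1) x - c m x| + ∑ x ∈ range d, |r (m + 1) x - c (m + 1) x| := by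
      rw [← sum_add_distrib, ← sum_add_distrib]
      refine sum_le_sum fun x _ => ?_
      have h := abs_sub_le (r 0 x) (c m x) (c (m + 1) x)
      have h' := abs_sub_le (c m x) (r (m + 1) x) (c (m + 1) x)
      rw [abs_sub_comm (c m x) (r (m + 1) x)] at h'
      linarith
    rw [sum_range_succ e, sum_range_succ e']
    linarith [hr (m + 1) le_rfl, hc m (by omega)]

open Finset in
/-- If the distribution `p` on `{0,…,d}` changes by little under the cyclic shift of `{0,…,d−1}`
and gives little mass to the outcome `d`, then it is close to uniform on `{0,…,d−1}`. -/
theorem sum_abs_sub_inv_le {d : ℕ} (hd : 1 ≤ d) {p : ℕ → ℝ}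
    (hp0 : 0 ≤ p d) (hp : ∑ x ∈ range (d + 1), p x = 1) :
    ∑ x ∈ range d, |p x - 1 / d|
      ≤ d / 4 * ∑ x ∈ range d, |p x - p ((x + 1) % d)| + p d := by
  have hd0 : (0 : ℝ) < d := by exact_mod_cast hd
  have hmean := sum_abs_sub_mean_le hd p
    (R := (∑ x ∈ range d, |p x - p ((x + 1) % d)|) / 2) fun i hi j hj => by
      linarith [two_mul_sub_le_sum_abs_sub_cyclic p hi hj]
  have hsum : ∑ x ∈ range d, p x = 1 - p d := by
    rw [sum_range_succ] at hp; linarith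
  rw [hsum] at hmean
  calc ∑ x ∈ range d, |p x - 1 / d|
      ≤ ∑ x ∈ range d, (|p x - (1 - p d) / d| + p d / d) := by
        refine sum_le_sum fun x _ => ?_
        have h := abs_sub_le (p x) ((1 - p d) / d) (1 / d)
        rwa [show (1 - p d) / d - 1 / d = -(p d / d) by ring, abs_neg,
          abs_of_nonneg (div_nonneg hp0 hd0.le)] at h
    _ = ∑ x ∈ range d, |p x - (1 - p d) / d| + p d := by
        rw [sum_add_distrib, sum_const, card_range, nsmul_eq_mul, mul_div_cancel₀ _ hd0.ne']
    _ ≤ _ := by linarith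

/-- **Single-hidden-variable core of Lemma 2 of the paper.**
Let `P a b` (for `a ∈ 𝒜_n`, `b ∈ ℬ_n`) be a no-signalling family of probability
distributions on pairs of outcomes in `{0,…,d} × {0,…,d}`.  Then the outcome
distribution `P(·|a=0)` for setting `a = 0` is close to uniform on `{0,…,d−1}`:
`Σ_{x=0}^{d−1} |P(x|0) − 1/d| ≤ (d/2)·I_{n,d}(P)`. -/
theorem chainedBell_bounds_dist_to_uniform (n d : ℕ) (hn : 1 ≤ n) (hd : 1 ≤ d)
    (P : ℕ → ℕ → ℕ → ℕ → ℝ)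
    (hpos : ∀ a ∈ settingsA n, ∀ b ∈ settingsB n, ∀ x y : ℕ, 0 ≤ P a b x y)
    (hnorm : ∀ a ∈ settingsA n, ∀ b ∈ settingsB n,
      ∑ x ∈ Finset.range (d + 1), ∑ y ∈ Finset.range (d + 1), P a b x y = 1)
    (hnsA : ∀ a ∈ settingsA n, ∀ b ∈ settingsB n, ∀ b' ∈ settingsB n,
      ∀ x ∈ Finset.range (d + 1),
        ∑ y ∈ Finset.range (d + 1), P a b x y = ∑ y ∈ Finset.range (d + 1), P a b' x y)
    (hnsB : ∀ a ∈ settingsA n, ∀ a' ∈ settingsA n, ∀ b ∈ settingsB n,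
      ∀ y ∈ Finset.range (d + 1),
        ∑ x ∈ Finset.range (d + 1), P a b x y = ∑ x ∈ Finset.range (d + 1), P a' b x y) :
    ∑ x ∈ Finset.range d, |(∑ y ∈ Finset.range (d + 1), P 0 1 x y) - 1 / d| ≤
      ((d : ℝ) / 2) * chainedBell n d P := by
  obtain ⟨m, rfl⟩ := Nat.exists_eq_add_of_le' hn
  have hA : ∀ i ≤ m, 2 * i ∈ settingsA (m + 1) := fun i hi =>
    Finset.mem_image_of_mem _ (Finset.mem_range.2 (by omega))
  have hB : ∀ i ≤ m, 2 * i + 1 ∈ settingsB (m + 1) := fun i hi =>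
    Finset.mem_image_of_mem (fun i => 2 * i + 1) (Finset.mem_range.2 (by omega))
  have hA0 := hA 0 m.zero_le
  have hB0 := hB 0 m.zero_le
  rw [mul_zero] at hA0
  rw [mul_zero, zero_add] at hB0
  let r : ℕ → ℕ → ℝ := fun i x => ∑ y ∈ Finset.range (d + 1), P (2 * i) 1 x y
  let c : ℕ → ℕ → ℝ := fun i y => ∑ x ∈ Finset.range (d + 1), P 0 (2 * i + 1) x y
  have hr : ∀ i ≤ m, ∀ x, 0 ≤ r i x := fun i hi x =>
    Finset.sum_nonneg fun y _ => hpos _ (hA i hi) _ hB0 x y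
  have hc : ∀ i ≤ m, ∀ y, 0 ≤ c i y := fun i hi y =>
    Finset.sum_nonneg fun x _ => hpos _ hA0 _ (hB i hi) x y
  have hrow : ∀ i ≤ m, ∀ j ≤ m, ∀ x ≤ d,
      ∑ y ∈ Finset.range (d + 1), P (2 * i) (2 * j + 1) x y = r i x := fun i hi j hj x hx =>
    hnsA _ (hA i hi) _ (hB j hj) _ hB0 x (Finset.mem_range.2 (by omega))
  have hcol : ∀ i ≤ m, ∀ j ≤ m, ∀ y ≤ d,
      ∑ x ∈ Finset.range (d + 1), P (2 * i) (2 * j + 1) x y = c j y := fun i hi j hj y hy =>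
    hnsB _ (hA i hi) _ hA0 _ (hB j hj) y (Finset.mem_range.2 (by omega))
  have hedge : ∀ i ≤ m, ∀ j ≤ m, ∀ σ : ℕ → ℕ,
      Set.BijOn σ (Finset.range d : Set ℕ) (Finset.range d : Set ℕ) →
      ∑ x ∈ Finset.range d, |r i x - c j (σ x)| + r i d + c j d
        ≤ 2 * (1 - ∑ x ∈ Finset.range d, P (2 * i) (2 * j + 1) x (σ x)) := by
    intro i hi j hj σ hσ
    have h := sum_abs_marginal_sub_le (hpos _ (hA i hi) _ (hB j hj))
      (hnorm _ (hA i hi) _ (hB j hj)) hσ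
    rw [hrow i hi j hj d le_rfl, hcol i hi j hj d le_rfl] at h
    convert h using 5 with x hx
    have hσx := Finset.mem_range.1 (hσ.mapsTo hx)
    rw [hrow i hi j hj x (Finset.mem_range.1 hx).le, hcol i hi j hj _ hσx.le]
  have hchain := sum_abs_sub_le_of_chain m (fun i hi => hr i hi d) (fun i hi => hc i hi d)
    (fun i hi => hedge i hi i hi id (Set.bijOn_id _))
    (fun i hi => hedge (i + 1) hi i hi.le id (Set.bijOn_id _))
  have hlast := hedge 0 m.zero_le m le_rfl _ (bijOn_add_one_mod d)
  have hI : 2 * (∑ i ∈ Finset.range (m + 1),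
        (1 - ∑ x ∈ Finset.range d, P (2 * i) (2 * i + 1) x (id x))
      + ∑ i ∈ Finset.range m, (1 - ∑ x ∈ Finset.range d, P (2 * (i + 1)) (2 * i + 1) x (id x)))
      + 2 * (1 - ∑ x ∈ Finset.range d, P (2 * 0) (2 * m + 1) x ((x + 1) % d))
      = 2 * chainedBell (m + 1) d P := by
    rw [chainedBell, sum_settings_adjacent m fun a b => ∑ x ∈ Finset.range d, P a b x x,
      Finset.sum_sub_distrib, Finset.sum_sub_distrib,
      show 2 * (m + 1) - 1 = 2 * m + 1 by omega]
    simp only [id, Finset.sum_const, Finset.card_range, nsmul_eq_mul, mul_zero]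
    push_cast
    ring
  have hr1 : ∑ x ∈ Finset.range (d + 1), r 0 x = 1 := hnorm _ hA0 _ hB0
  have hδ := hr 0 m.zero_le d
  have hδ' := hc m le_rfl d
  change ∑ x ∈ Finset.range d, |r 0 x - 1 / d| ≤ _
  rcases hd.eq_or_lt with rfl | hd2
  · have hc1 : ∑ y ∈ Finset.range (1 + 1), c m y = 1 := by
      rw [Finset.sum_comm]
      exact hnorm _ hA0 _ (hB m le_rfl)
    simp only [Finset.sum_range_succ, Finset.sum_range_zero, zero_add, Nat.mod_one, id] at *
    have h₁ := neg_abs_le (r 0 0 - c m 0)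
    rw [abs_of_nonpos (by push_cast; linarith)]
    push_cast
    linarith
  · have hshift : ∑ x ∈ Finset.range d, |r 0 x - r 0 ((x + 1) % d)|
        ≤ ∑ x ∈ Finset.range d, |r 0 x - c m ((x + 1) % d)|
          + ∑ x ∈ Finset.range d, |r 0 x - c m (id x)| := by
      have hbij := bijOn_add_one_mod d
      rw [← Finset.sum_nbij _ hbij.mapsTo hbij.injOn hbij.surjOn
        (f := fun x => |r 0 ((x + 1) % d) - c m ((x + 1) % d)|)
        (g := fun x => |r 0 x - c m (id x)|) fun _ _ => rfl,
        ← Finset.sum_add_distrib]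
      refine Finset.sum_le_sum fun x _ => ?_
      have h := abs_sub_le (r 0 x) (c m ((x + 1) % d)) (r 0 ((x + 1) % d))
      rwa [abs_sub_comm (c m ((x + 1) % d))] at h
    have huniform := sum_abs_sub_inv_le hd hδ hr1
    have hd2' : (2 : ℝ) ≤ d := by exact_mod_cast hd2
    have htotal : ∑ x ∈ Finset.range d, |r 0 x - r 0 ((x + 1) % d)| + 2 * r 0 d
        ≤ 2 * chainedBell (m + 1) d P := by
      simp only [id] at *
      linarith
    nlinarith [mul_le_mul_of_nonneg_left htotal (by linarith : (0 : ℝ) ≤ d / 4),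
      mul_nonneg hδ (sub_nonneg.2 hd2')]
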